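/- Let F be ℝ or ℂ and let m, n be positive integers. Let φ : M_{mn}(F) → M_{mn}(F) be a linear RT-symmetric map, i.e. tr(φ(A)·B) = tr(φ(B)·A) for all A, B ∈ M_{mn}(F). Then tr(φ(A ⊕ B)) = tr(A ⊕ B) for all A ∈ M_m(F) and B ∈ M_n(F) if and only if tr₁(φ(I_{mn})) = m·I_n and tr₂(φ(I_{mn})) = n·I_m. -/

import Mathlib

open Matrix Kronecker BigOperators

/-- The Kronecker sum `A ⊕ B = A ⊗ Iₙ + Iₘ ⊗ B`. -/
def kronSum {F : Type*} [CommRing F] {m n : ℕ}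
    (A : Matrix (Fin m) (Fin m) F) (B : Matrix (Fin n) (Fin n) F) :
    Matrix (Fin m × Fin n) (Fin m × Fin n) F :=
  A ⊗ₖ (1 : Matrix (Fin n) (Fin n) F) + (1 : Matrix (Fin m) (Fin m) F) ⊗ₖ B

/-- The first partial trace `tr₁(P) = Σⱼ Pⱼⱼ` (sum of the diagonal blocks). -/
def ptrace1 {F : Type*} [AddCommMonoid F] {m n : ℕ}
    (P : Matrix (Fin m × Fin n) (Fin m × Fin n) F) :
    Matrix (Fin n) (Fin n) F :=
  Matrix.of fun a b => ∑ k : Fin m, P (k, a) (k, b)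

/-- The second partial trace `tr₂(P) = Σ_{k,l} tr(P_{kl}) E_{kl}` (blockwise trace). -/
def ptrace2 {F : Type*} [AddCommMonoid F] {m n : ℕ}
    (P : Matrix (Fin m × Fin n) (Fin m × Fin n) F) :
    Matrix (Fin m) (Fin m) F :=
  Matrix.of fun k l => ∑ a : Fin n, P (k, a) (l, a)

theorem trace_mul_kronecker_one {F : Type*} [CommRing F] {m n : ℕ}
    (P : Matrix (Fin m × Fin n) (Fin m × Fin n) F) (X : Matrix (Fin m) (Fin m) F) :
    (P * (X ⊗ₖ (1 : Matrix (Fin n) (Fin n) F))).trace = (ptrace2 P * X).trace := by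
  simp only [trace, diag_apply, mul_apply, kroneckerMap_apply, ptrace2, of_apply,
    Fintype.sum_prod_type, one_apply, mul_ite, mul_one, mul_zero, Finset.sum_ite_eq',
    Finset.mem_univ, if_true, Finset.sum_mul]
  exact Finset.sum_congr rfl fun _ _ => Finset.sum_comm

theorem trace_mul_one_kronecker {F : Type*} [CommRing F] {m n : ℕ}
    (P : Matrix (Fin m × Fin n) (Fin m × Fin n) F) (Y : Matrix (Fin n) (Fin n) F) :
    (P * ((1 : Matrix (Fin m) (Fin m) F) ⊗ₖ Y)).trace = (ptrace1 P * Y).trace := by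
  simp only [trace, diag_apply, mul_apply, kroneckerMap_apply, ptrace1, of_apply,
    Fintype.sum_prod_type_right, one_apply, ite_mul, one_mul, zero_mul, mul_ite, mul_zero,
    Finset.sum_ite_eq', Finset.mem_univ, if_true, Finset.sum_mul]
  exact Finset.sum_congr rfl fun _ _ => Finset.sum_comm

theorem trace_mul_kronSum {F : Type*} [CommRing F] {m n : ℕ}
    (P : Matrix (Fin m × Fin n) (Fin m × Fin n) F)
    (X : Matrix (Fin m) (Fin m) F) (Y : Matrix (Fin n) (Fin n) F) :
    (P * kronSum X Y).trace = (ptrace2 P * X).trace + (ptrace1 P * Y).trace := by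
  rw [kronSum, mul_add, trace_add, trace_mul_kronecker_one, trace_mul_one_kronecker]

theorem trace_kronSum {F : Type*} [CommRing F] {m n : ℕ}
    (X : Matrix (Fin m) (Fin m) F) (Y : Matrix (Fin n) (Fin n) F) :
    (kronSum X Y).trace = n * X.trace + m * Y.trace := by
  simp [kronSum, trace_kronecker, mul_comm]

/-- Corollary 3.6: an RT-symmetric linear map `φ` (i.e. `tr(φ(A)B) = tr(φ(B)A)` for
all `A, B`) preserves the trace of all Kronecker sums iff
`tr₁(φ(I)) = m·Iₙ` and `tr₂(φ(I)) = n·Iₘ`. -/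
theorem trace_kronSum_preserved_iff_of_rt_symmetric
    {F : Type*} [RCLike F] {m n : ℕ} (hm : 0 < m) (hn : 0 < n)
    (φ : Matrix (Fin m × Fin n) (Fin m × Fin n) F →ₗ[F]
         Matrix (Fin m × Fin n) (Fin m × Fin n) F)
    (hsym : ∀ A B : Matrix (Fin m × Fin n) (Fin m × Fin n) F,
        (φ A * B).trace = (φ B * A).trace) :
    (∀ (X : Matrix (Fin m) (Fin m) F) (Y : Matrix (Fin n) (Fin n) F),
        (φ (kronSum X Y)).trace = (kronSum X Y).trace) ↔
      (ptrace1 (φ 1) = (m : F) • (1 : Matrix (Fin n) (Fin n) F) ∧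
       ptrace2 (φ 1) = (n : F) • (1 : Matrix (Fin m) (Fin m) F)) := by
  have key : ∀ S, (φ S).trace = (φ 1 * S).trace := fun S => by
    rw [← hsym S 1, mul_one]
  simp only [key, trace_mul_kronSum, trace_kronSum]
  constructor
  · intro h
    constructor
    · refine ext_iff_trace_mul_right.2 fun Y => ?_
      simpa using h 0 Y
    · refine ext_iff_trace_mul_right.2 fun X => ?_
      simpa using h X 0
  · rintro ⟨h₁, h₂⟩ X Y
    simp [h₁, h₂]
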